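/- For each positive integer i let S̃_i denote the subgroup of B_{4,2} generated by the two elements x_i and yxy, where x_i is evaluated at x = X, y = Y and yxy = Y·X·Y. Then for every pair (i,j) of positive integers there exists a group isomorphism η̃_{ij} : S̃_i → S̃_j with η̃_{ij}(x_i) = x_j and η̃_{ij}(yxy) = yxy. -/

import Mathlib

/-!
Common setup: the commutator convention `[a,b] = a⁻¹b⁻¹ab` of the paper, the sequence
`x₀ = x`, `x_{i+1} = [yxy, x_i]`, the Laurent polynomial ring `R = 𝔽₂[t,t⁻¹]`, and the
images `X`, `Y` of `σ₁σ₂σ₃` and `σ₁σ₂σ₃σ₁` in `GL(3, R)` under the mod-2 reduced Burau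
representation of the 4-strand braid group.
-/

open Matrix LaurentPolynomial

noncomputable section

set_option maxRecDepth 100000

/-- The paper's commutator convention: `[a,b] = a⁻¹b⁻¹ab`. -/
def br {G : Type*} [Group G] (a b : G) : G := a⁻¹ * b⁻¹ * a * b

/-- The recursively defined elements `x₀ = x`, `x_{i+1} = [yxy, x_i]`. -/
def xseq {G : Type*} [Group G] (x y : G) : ℕ → G
  | 0 => x
  | n + 1 => br (y * x * y) (xseq x y n)

/-- `R = 𝔽₂[t,t⁻¹]`, the ring of Laurent polynomials over the field with two elements. -/
abbrev R2 : Type := LaurentPolynomial (ZMod 2)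

instance : CharP R2 2 := charP_of_injective_algebraMap (algebraMap (ZMod 2) R2).injective 2

/-- The matrix `X = t·!![0,0,1; 1,0,1; 0,1,1]`. -/
def Xmat : Matrix (Fin 3) (Fin 3) R2 := (T 1 : R2) • !![0,0,1; 1,0,1; 0,1,1]

/-- The matrix `Y = t·!![0,0,1; t,1,1; 0,1,1]`. -/
def Ymat : Matrix (Fin 3) (Fin 3) R2 := (T 1 : R2) • !![0,0,1; T 1,1,1; 0,1,1]

/-- An explicit inverse for `Xmat`. -/
def Xmatinv : Matrix (Fin 3) (Fin 3) R2 := (T (-1) : R2) • !![1,1,0; 1,0,1; 1,0,0]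

/-- An explicit inverse for `Ymat`. -/
def Ymatinv : Matrix (Fin 3) (Fin 3) R2 := (T (-2) : R2) • !![0,1,1; T 1,0,T 1; T 1,0,0]

lemma Xmat_mul_Xmatinv : Xmat * Xmatinv = 1 := by
  rw [Xmat, Xmatinv, Matrix.smul_mul, Matrix.mul_smul, smul_smul, ← T_add]
  simp only [Matrix.mul_fin_three, mul_zero, zero_mul, mul_one, one_mul, add_zero, zero_add,
    ← T_add, CharTwo.add_self_eq_zero]
  rw [Matrix.one_fin_three]
  simp only [Matrix.smul_of, Matrix.smul_cons, smul_eq_mul, Matrix.smul_empty, ← T_add,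
    mul_zero, mul_one]
  norm_num [T_zero]

lemma Xmatinv_mul_Xmat : Xmatinv * Xmat = 1 := by
  rw [Xmat, Xmatinv, Matrix.smul_mul, Matrix.mul_smul, smul_smul, ← T_add]
  simp only [Matrix.mul_fin_three, mul_zero, zero_mul, mul_one, one_mul, add_zero, zero_add,
    ← T_add, CharTwo.add_self_eq_zero]
  rw [Matrix.one_fin_three]
  simp only [Matrix.smul_of, Matrix.smul_cons, smul_eq_mul, Matrix.smul_empty, ← T_add,
    mul_zero, mul_one]
  norm_num [T_zero]

lemma Ymat_mul_Ymatinv : Ymat * Ymatinv = 1 := by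
  rw [Ymat, Ymatinv, Matrix.smul_mul, Matrix.mul_smul, smul_smul, ← T_add]
  simp only [Matrix.mul_fin_three, mul_zero, zero_mul, mul_one, one_mul, add_zero, zero_add,
    ← T_add, CharTwo.add_self_eq_zero]
  rw [Matrix.one_fin_three]
  simp only [Matrix.smul_of, Matrix.smul_cons, smul_eq_mul, Matrix.smul_empty, ← T_add,
    mul_zero, mul_one]
  norm_num [T_zero]

lemma Ymatinv_mul_Ymat : Ymatinv * Ymat = 1 := by
  rw [Ymat, Ymatinv, Matrix.mul_smul, Matrix.smul_mul, smul_smul, ← T_add]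
  simp only [Matrix.mul_fin_three, mul_zero, zero_mul, mul_one, one_mul, add_zero, zero_add,
    ← T_add, CharTwo.add_self_eq_zero]
  rw [Matrix.one_fin_three]
  simp only [Matrix.smul_of, Matrix.smul_cons, smul_eq_mul, Matrix.smul_empty, ← T_add,
    mul_zero, mul_one]
  norm_num [T_zero]

/-- `X ∈ GL(3, 𝔽₂[t,t⁻¹])`, the mod-2 reduced Burau image of `σ₁σ₂σ₃`. -/
def X : GL (Fin 3) R2 := ⟨Xmat, Xmatinv, Xmat_mul_Xmatinv, Xmatinv_mul_Xmat⟩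

/-- `Y ∈ GL(3, 𝔽₂[t,t⁻¹])`, the mod-2 reduced Burau image of `σ₁σ₂σ₃σ₁`. -/
def Y : GL (Fin 3) R2 := ⟨Ymat, Ymatinv, Ymat_mul_Ymatinv, Ymatinv_mul_Ymat⟩

/-- `S̃_i`, the subgroup of `GL(3,R)` (a subgroup of `B_{4,2}`) generated by `x_i` and
`yxy`, evaluated at `x = X`, `y = Y`. -/
def Sti (i : ℕ) : Subgroup (GL (Fin 3) R2) :=
  Subgroup.closure {xseq X Y i, Y * X * Y}

/-- Explicit form of `Y X Y`. -/
def Dm (t : R2) : Matrix (Fin 3) (Fin 3) R2 :=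
  !![t^4,0,0; t^4,t^3+t^4,t^4; t^4,t^3,0]

/-- Explicit form of `x₁` (with `u = t⁻¹`). -/
def x1m (t u : R2) : Matrix (Fin 3) (Fin 3) R2 :=
  !![u+1,1,u; 1+t,t,1+t; u+1+t,t,u+t]

/-- The intertwiner. -/
def Qm (t : R2) : Matrix (Fin 3) (Fin 3) R2 :=
  !![1+t+t^2+t^3,0,0; t^3,t,t^3; 1,t^2,t+t^2+t^3]

lemma two_zero : (2 : R2) = 0 := CharTwo.two_eq_zero

lemma YXY_val : ((Y * X * Y : GL (Fin 3) R2) : Matrix (Fin 3) (Fin 3) R2) = Dm (T 1) := by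
  have h2 := two_zero
  change Ymat * Xmat * Ymat = _
  simp only [Ymat, Xmat, Dm]
  generalize (T 1 : R2) = t
  refine Matrix.ext fun i j => ?_
  fin_cases i <;> fin_cases j <;> simp [Matrix.mul_apply, Fin.sum_univ_three] <;> grind

lemma rel1 : Xmat * Dm (T 1) * x1m (T 1) (T (-1)) = Dm (T 1) * Xmat := by
  have h2 := two_zero
  have h : (T 1 : R2) * T (-1) = 1 := by rw [← T_add]; simp
  simp only [Xmat, Dm, x1m]
  generalize (T 1 : R2) = t at *
  generalize (T (-1) : R2) = u at *
  refine Matrix.ext fun i j => ?_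
  fin_cases i <;> fin_cases j <;> simp [Matrix.mul_apply, Fin.sum_univ_three] <;> grind

lemma relQD (t : R2) : Qm t * Dm t = Dm t * Qm t := by
  have h2 := two_zero
  simp only [Qm, Dm]
  refine Matrix.ext fun i j => ?_
  fin_cases i <;> fin_cases j <;> simp [Matrix.mul_apply, Fin.sum_univ_three] <;> grind

lemma relQ1 : x1m (T 1) (T (-1)) * Dm (T 1) * (Qm (T 1) * x1m (T 1) (T (-1)))
    = Dm (T 1) * x1m (T 1) (T (-1)) * Qm (T 1) := by
  have h2 := two_zero
  have h : (T 1 : R2) * T (-1) = 1 := by rw [← T_add]; simp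
  simp only [Qm, Dm, x1m]
  generalize (T 1 : R2) = t at *
  generalize (T (-1) : R2) = u at *
  refine Matrix.ext fun i j => ?_
  fin_cases i <;> fin_cases j <;> simp [Matrix.mul_apply, Fin.sum_univ_three] <;> grind

lemma detQ : (Qm (T 1)).det ≠ 0 := by
  have h2 := two_zero
  have h : (Qm (T 1)).det = (T 1)^2 * (1 + T 1)^6 := by
    simp only [Qm]
    generalize (T 1 : R2) = t
    simp [Matrix.det_fin_three]
    grind
  rw [h]
  have h1 : (T 1 : R2) ≠ 0 := (isUnit_T 1).ne_zero
  have h3 : (1 + T 1 : R2) ≠ 0 := by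
    intro h
    have h4 : (T 1 : R2) = T 0 := by rw [T_zero]; grind
    have h5 := congrArg LaurentPolynomial.degree h4
    rw [degree_T, degree_T] at h5
    exact absurd (WithBot.coe_injective h5) (by norm_num)
  exact mul_ne_zero (pow_ne_zero _ h1) (pow_ne_zero _ h3)

lemma br_map {G H : Type*} [Group G] [Group H] (f : G →* H) (a b : G) :
    f (br a b) = br (f a) (f b) := by simp [br]

lemma br_conj {G : Type*} [Group G] (q a b : G) :
    q * br a b * q⁻¹ = br (q * a * q⁻¹) (q * b * q⁻¹) := by simp [br, mul_assoc]

lemma x1_val : ((xseq X Y 1 : GL (Fin 3) R2) : Matrix (Fin 3) (Fin 3) R2)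
    = x1m (T 1) (T (-1)) := by
  have hD := YXY_val
  have e : X * (Y * X * Y) * xseq X Y 1 = (Y * X * Y) * X := by
    simp only [xseq, br]; group
  have e' := congrArg (fun g : GL (Fin 3) R2 => (g : Matrix (Fin 3) (Fin 3) R2)) e
  have hX : ((X : GL (Fin 3) R2) : Matrix (Fin 3) (Fin 3) R2) = Xmat := rfl
  have hu : IsUnit (Xmat * Dm (T 1)) := by
    rw [← hD, ← hX, ← Units.val_mul]; exact Units.isUnit _
  apply hu.mul_left_cancel
  rw [rel1, ← hD, ← hX, ← Units.val_mul, ← Units.val_mul, ← Units.val_mul, e]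

abbrev KK : Type := FractionRing R2

/-- `GL₃(R) → GL₃(K)`. -/
def phi : GL (Fin 3) R2 →* GL (Fin 3) KK :=
  Matrix.GeneralLinearGroup.map (algebraMap R2 KK)

lemma phi_val (g : GL (Fin 3) R2) : ((phi g : GL (Fin 3) KK) : Matrix (Fin 3) (Fin 3) KK)
    = (algebraMap R2 KK).mapMatrix (g : Matrix (Fin 3) (Fin 3) R2) := rfl

lemma phi_inj : Function.Injective phi := by
  intro a b h
  refine Units.ext <| Matrix.ext fun i j => ?_
  have := congrArg (fun g : GL (Fin 3) KK => (g : Matrix (Fin 3) (Fin 3) KK) i j) h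
  exact IsFractionRing.injective R2 KK this

/-- The intertwiner over the fraction field. -/
def Q : GL (Fin 3) KK :=
  Matrix.GeneralLinearGroup.mkOfDetNeZero ((algebraMap R2 KK).mapMatrix (Qm (T 1))) (by
    rw [← RingHom.map_det]
    intro h
    exact detQ (IsFractionRing.injective R2 KK (by rw [h, map_zero])))

lemma Q_val : ((Q : GL (Fin 3) KK) : Matrix (Fin 3) (Fin 3) KK)
    = (algebraMap R2 KK).mapMatrix (Qm (T 1)) := rfl

lemma Q_D : Q * phi (Y * X * Y) * Q⁻¹ = phi (Y * X * Y) := by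
  rw [mul_inv_eq_iff_eq_mul]
  apply Units.ext
  rw [Units.val_mul, Units.val_mul, phi_val, Q_val, YXY_val, ← map_mul, ← map_mul, relQD]

lemma Q_1 : Q * phi (xseq X Y 1) * Q⁻¹ = phi (xseq X Y 2) := by
  have e : xseq X Y 2 = (xseq X Y 1 * (Y * X * Y))⁻¹ * ((Y * X * Y) * xseq X Y 1) := by
    change br (Y * X * Y) (xseq X Y 1) = _
    simp only [br]; group
  have hD := YXY_val
  have hx := x1_val
  generalize Y * X * Y = D at *
  generalize xseq X Y 1 = x1 at *
  rw [mul_inv_eq_iff_eq_mul, e, map_mul, map_inv, mul_assoc, eq_inv_mul_iff_mul_eq,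
    map_mul, map_mul]
  apply Units.ext
  simp only [Units.val_mul]
  simp only [phi_val, Q_val, hD, hx, ← map_mul, relQ1]

lemma Q_n (n : ℕ) : Q * phi (xseq X Y (n + 1)) * Q⁻¹ = phi (xseq X Y (n + 2)) := by
  induction n with
  | zero => exact Q_1
  | succ n ih =>
    change Q * phi (br (Y * X * Y) (xseq X Y (n + 1))) * Q⁻¹
      = phi (br (Y * X * Y) (xseq X Y (n + 2)))
    rw [br_map, br_conj, ih, Q_D, br_map]

/-- An isomorphism of subgroups generated by pairs. -/
lemma pair_iso {G H : Type*} [Group G] [Group H] (f g : G →* H)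
    (hf : Function.Injective f) (hg : Function.Injective g) (a b d : G)
    (hab : f a = g b) (hd : f d = g d) :
    ∃ η : Subgroup.closure {a, d} ≃* Subgroup.closure {b, d},
      ∀ z, g (η z : G) = f (z : G) := by
  have hm : (Subgroup.closure {a, d}).map f = (Subgroup.closure {b, d}).map g := by
    rw [MonoidHom.map_closure, MonoidHom.map_closure, Set.image_pair, Set.image_pair, hab, hd]
  refine ⟨((Subgroup.equivMapOfInjective _ f hf).trans (MulEquiv.subgroupCongr hm)).trans
    (Subgroup.equivMapOfInjective _ g hg).symm, fun z => ?_⟩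
  have := congrArg Subtype.val ((Subgroup.equivMapOfInjective (Subgroup.closure {b, d}) g
    hg).apply_symm_apply (MulEquiv.subgroupCongr hm (Subgroup.equivMapOfInjective _ f hf z)))
  exact this

lemma step (n : ℕ) (k : ℕ) : ∃ q : GL (Fin 3) KK,
    q * phi (Y * X * Y) * q⁻¹ = phi (Y * X * Y) ∧
    q * phi (xseq X Y (n + 1)) * q⁻¹ = phi (xseq X Y (n + 1 + k)) := by
  induction k with
  | zero => exact ⟨1, by simp, by simp⟩
  | succ k ih =>
    obtain ⟨q, h1, h2⟩ := ih
    refine ⟨Q * q, ?_, ?_⟩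
    · rw [_root_.mul_inv_rev]
      calc _ = Q * (q * phi (Y * X * Y) * q⁻¹) * Q⁻¹ := by group
        _ = _ := by rw [h1, Q_D]
    · rw [_root_.mul_inv_rev]
      calc _ = Q * (q * phi (xseq X Y (n + 1)) * q⁻¹) * Q⁻¹ := by group
        _ = _ := by
          rw [h2]
          have := Q_n (n + k)
          rw [show n + 1 + k = n + k + 1 by omega, this,
            show n + 1 + (k + 1) = n + k + 2 by omega]

lemma step' (i j : ℕ) (hi : 1 ≤ i) (hj : 1 ≤ j) : ∃ q : GL (Fin 3) KK,
    q * phi (Y * X * Y) * q⁻¹ = phi (Y * X * Y) ∧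
    q * phi (xseq X Y i) * q⁻¹ = phi (xseq X Y j) := by
  obtain ⟨q, h1, h2⟩ := step 0 (i - 1)
  obtain ⟨r, h3, h4⟩ := step 0 (j - 1)
  rw [show 0 + 1 + (i - 1) = i by omega] at h2
  rw [show 0 + 1 + (j - 1) = j by omega] at h4
  refine ⟨r * q⁻¹, ?_, ?_⟩
  · have h5 : q⁻¹ * phi (Y * X * Y) * q = phi (Y * X * Y) := by
      conv_lhs => rw [← h1]
      group
    calc _ = r * (q⁻¹ * phi (Y * X * Y) * q) * r⁻¹ := by group
      _ = _ := by rw [h5, h3]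
  · rw [← h2, ← h4]; group


/-- **Lemma 3.4.** For every pair `(i,j)` of positive integers there is a group
isomorphism `η̃_{ij} : S̃_i → S̃_j` with `η̃_{ij}(x_i) = x_j` and `η̃_{ij}(yxy) = yxy`. -/
theorem statement9 (i j : ℕ) (hi : 1 ≤ i) (hj : 1 ≤ j) :
    ∃ η : Sti i ≃* Sti j,
      η ⟨xseq X Y i, Subgroup.subset_closure (Set.mem_insert _ _)⟩ =
          ⟨xseq X Y j, Subgroup.subset_closure (Set.mem_insert _ _)⟩ ∧
        η ⟨Y * X * Y, Subgroup.subset_closure (Set.mem_insert_of_mem _ rfl)⟩ =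
          ⟨Y * X * Y, Subgroup.subset_closure (Set.mem_insert_of_mem _ rfl)⟩ := by
  obtain ⟨q, h1, h2⟩ := step' i j hi hj
  have hinj : Function.Injective ((MulAut.conj q).toMonoidHom.comp phi) :=
    (MulAut.conj q).injective.comp phi_inj
  obtain ⟨η, hη⟩ := pair_iso ((MulAut.conj q).toMonoidHom.comp phi) phi hinj phi_inj
    (xseq X Y i) (xseq X Y j) (Y * X * Y) h2 h1
  refine ⟨η, ?_, ?_⟩
  · apply Subtype.ext
    apply phi_inj
    exact (hη _).trans h2
  · apply Subtype.ext
    apply phi_inj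
    exact (hη _).trans h1
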